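/- arXiv:2405.20586 — 2 statements merged into one kernel-verified Lean document; each statement's English description precedes it below -/
import Mathlib

section
/- Let E = {(η_i, ρ_i)}_{i=1}^n be a two-qubit quantum state ensemble (states on C^2 ⊗ C^2), let q ∈ ℝ and j ∈ {1,...,n}. Then Q_j(E) = q < C_j(E) if and only if qρ_0 − η_j ρ_j is a weakly-optimal entanglement witness, i.e., qρ_0 − η_j ρ_j is block positive but not positive semidefinite and there exists a separable state σ with Tr[σ(qρ_0 − η_j ρ_j)] = 0. -/
open ComplexOrder

open Kronecker

/-- A density matrix: positive semidefinite with unit trace. -/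
def IsState {ι : Type*} [Fintype ι] (ρ : Matrix ι ι ℂ) : Prop :=
  ρ.PosSemidef ∧ ρ.trace = 1

/-- A separable operator on a bipartite space: a conic combination of product states. -/
def IsSep {a b : Type*} [Fintype a] [Fintype b]
    (E : Matrix (a × b) (a × b) ℂ) : Prop :=
  ∃ (L : ℕ) (p : Fin L → ℝ) (σ : Fin L → Matrix a a ℂ) (τ : Fin L → Matrix b b ℂ),
    (∀ l, 0 ≤ p l) ∧ (∀ l, IsState (σ l)) ∧ (∀ l, IsState (τ l)) ∧
    E = ∑ l, (p l : ℂ) • (σ l ⊗ₖ τ l)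

/-- A block-positive Hermitian operator: `Tr (E * F) ≥ 0` for every separable `F`. -/
def IsBlockPos {a b : Type*} [Fintype a] [Fintype b]
    (E : Matrix (a × b) (a × b) ℂ) : Prop :=
  E.IsHermitian ∧ ∀ F, IsSep F → 0 ≤ (E * F).trace

section PosSemidef

open scoped MatrixOrder

open Matrix

theorem Matrix.PosSemidef.exists_eq_conjTranspose_mul_self {n : Type*} [Fintype n]
    {A : Matrix n n ℂ} (hA : A.PosSemidef) : ∃ B : Matrix n n ℂ, A = Bᴴ * B := by
  classical
  exact CStarAlgebra.nonneg_iff_eq_star_mul_self.mp hA.nonneg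

end PosSemidef

namespace Matrix

theorem trace_mul_conjTranspose_mul_self {n : Type*} [Fintype n] (X Y : Matrix n n ℂ) :
    ((Xᴴ * X) * (Yᴴ * Y)).trace = ((X * Yᴴ)ᴴ * (X * Yᴴ)).trace := by
  rw [conjTranspose_mul, conjTranspose_conjTranspose, ← mul_assoc, trace_mul_comm]
  simp only [mul_assoc]

theorem PosSemidef.trace_mul_nonneg {n : Type*} [Fintype n] {A B : Matrix n n ℂ}
    (hA : A.PosSemidef) (hB : B.PosSemidef) : 0 ≤ (A * B).trace := by
  obtain ⟨X, rfl⟩ := hA.exists_eq_conjTranspose_mul_self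
  obtain ⟨Y, rfl⟩ := hB.exists_eq_conjTranspose_mul_self
  rw [trace_mul_conjTranspose_mul_self]
  exact (posSemidef_conjTranspose_mul_self _).trace_nonneg

theorem PosSemidef.mul_eq_zero_of_trace_mul_eq_zero {n : Type*} [Fintype n] {A B : Matrix n n ℂ}
    (hA : A.PosSemidef) (hB : B.PosSemidef) (h : (A * B).trace = 0) : A * B = 0 := by
  obtain ⟨X, rfl⟩ := hA.exists_eq_conjTranspose_mul_self
  obtain ⟨Y, rfl⟩ := hB.exists_eq_conjTranspose_mul_self
  rw [trace_mul_conjTranspose_mul_self, trace_conjTranspose_mul_self_eq_zero_iff] at h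
  rw [mul_assoc, ← mul_assoc X, h, zero_mul, mul_zero]

theorem IsHermitian.im_trace_mul {n : Type*} [Fintype n] {A B : Matrix n n ℂ}
    (hA : A.IsHermitian) (hB : B.IsHermitian) : (A * B).trace.im = 0 := by
  rw [← Complex.conj_eq_iff_im, starRingEnd_apply, ← trace_conjTranspose, conjTranspose_mul,
    hA.eq, hB.eq, trace_mul_comm]

theorem isCompact_setOf_trace_conjTranspose_mul_self_eq_one {n : Type*} [Fintype n] :
    IsCompact {B : Matrix n n ℂ | (Bᴴ * B).trace = 1} := by
  refine IsCompact.of_isClosed_subset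
    (isCompact_univ_pi fun _ : n => isCompact_univ_pi fun _ : n =>
      ProperSpace.isCompact_closedBall (0 : ℂ) 1)
    (isClosed_eq (by fun_prop) continuous_const) fun B hB => ?_
  refine fun i _ k _ => mem_closedBall_zero_iff.mpr ?_
  have hsum : ∑ k, ∑ i, ‖B i k‖ ^ 2 = 1 := by
    have h : (Bᴴ * B).trace = ((∑ k, ∑ i, ‖B i k‖ ^ 2 : ℝ) : ℂ) := by
      simp [trace, mul_apply, Complex.conj_mul']
    rw [Set.mem_ofPred_eq, h] at hB
    exact_mod_cast hB
  have hle : ‖B i k‖ ^ 2 ≤ 1 := by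
    rw [← hsum]
    calc ‖B i k‖ ^ 2 ≤ ∑ i, ‖B i k‖ ^ 2 :=
          Finset.single_le_sum (f := fun i => ‖B i k‖ ^ 2) (fun _ _ => by positivity)
            (Finset.mem_univ i)
      _ ≤ _ := Finset.single_le_sum (f := fun k => ∑ i, ‖B i k‖ ^ 2)
            (fun _ _ => by positivity) (Finset.mem_univ k)
  exact (sq_le_one_iff₀ (norm_nonneg _)).mp hle

/-- A two-by-two matrix of zero determinant, read as a vector, is a product vector. -/
theorem exists_apply_eq_mul_of_det_eq_zero {K : Type*} [Field K] {M : Matrix (Fin 2) (Fin 2) K}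
    (h : M.det = 0) : ∃ x y : Fin 2 → K, ∀ i k, M i k = x i * y k := by
  rw [det_fin_two] at h
  by_cases h00 : M 0 0 = 0
  · rw [h00, zero_mul, zero_sub, neg_eq_zero, mul_eq_zero] at h
    rcases h with h | h
    · exact ⟨![0, 1], ![M 1 0, M 1 1], by simp [Fin.forall_fin_two, h00, h]⟩
    · exact ⟨![M 0 1, M 1 1], ![0, 1], by simp [Fin.forall_fin_two, h00, h]⟩
  · refine ⟨![M 0 0, M 1 0], ![1, M 0 1 / M 0 0], ?_⟩
    simp only [Fin.forall_fin_two, Matrix.cons_val_zero, Matrix.cons_val_one]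
    refine ⟨⟨by ring, by field_simp⟩, by ring, ?_⟩
    field_simp
    linear_combination h

end Matrix

open Matrix

theorem isCompact_setOf_isState {n : Type*} [Fintype n] :
    IsCompact {σ : Matrix n n ℂ | IsState σ} := by
  convert (isCompact_setOf_trace_conjTranspose_mul_self_eq_one (n := n)).image
    (f := fun B => Bᴴ * B) (by fun_prop)
  ext σ
  constructor
  · rintro ⟨hσ, ht⟩
    obtain ⟨B, rfl⟩ := hσ.exists_eq_conjTranspose_mul_self
    exact ⟨B, ht, rfl⟩
  · rintro ⟨B, hB, rfl⟩
    exact ⟨posSemidef_conjTranspose_mul_self B, hB⟩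

theorem nonempty_setOf_isState {n : Type*} [Fintype n] [Nonempty n] :
    {σ : Matrix n n ℂ | IsState σ}.Nonempty := by
  classical
  obtain ⟨i⟩ := ‹Nonempty n›
  exact ⟨vecMulVec (Pi.single i 1) (star (Pi.single i 1)),
    posSemidef_vecMulVec_self_star _, by simp [trace_vecMulVec]⟩

theorem Matrix.PosSemidef.exists_eq_smul_isState {n : Type*} [Fintype n] [Nonempty n]
    {σ : Matrix n n ℂ} (hσ : σ.PosSemidef) :
    ∃ (r : ℝ) (σ' : Matrix n n ℂ), 0 ≤ r ∧ IsState σ' ∧ σ = (r : ℂ) • σ' := by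
  by_cases h : σ.trace = 0
  · obtain ⟨σ', hσ'⟩ := nonempty_setOf_isState (n := n)
    exact ⟨0, σ', le_rfl, hσ', by simpa using hσ.trace_eq_zero_iff.mp h⟩
  · obtain ⟨hre, him⟩ := Complex.le_def.mp hσ.trace_nonneg
    have hr : (σ.trace.re : ℂ) = σ.trace := Complex.ext rfl (by simpa using him)
    refine ⟨σ.trace.re, σ.trace⁻¹ • σ, hre, ⟨hσ.smul ?_, ?_⟩, ?_⟩
    · exact inv_nonneg.mpr hσ.trace_nonneg
    · simp [trace_smul, h]
    · rw [hr, smul_smul, mul_inv_cancel₀ h, one_smul]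

section

variable {a b : Type*} [Fintype a] [Fintype b]

theorem IsState.kronecker {σ : Matrix a a ℂ} {τ : Matrix b b ℂ} (hσ : IsState σ)
    (hτ : IsState τ) : IsState (σ ⊗ₖ τ) :=
  ⟨hσ.1.kronecker hτ.1, by rw [trace_kronecker, hσ.2, hτ.2, one_mul]⟩

theorem IsState.isSep_kronecker {σ : Matrix a a ℂ} {τ : Matrix b b ℂ} (hσ : IsState σ)
    (hτ : IsState τ) : IsSep (σ ⊗ₖ τ) :=
  ⟨1, fun _ => 1, fun _ => σ, fun _ => τ, fun _ => zero_le_one, fun _ => hσ, fun _ => hτ, by simp⟩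

theorem IsBlockPos.of_re_trace_nonneg {E : Matrix (a × b) (a × b) ℂ} (hE : E.IsHermitian)
    (h : ∀ σ τ, IsState σ → IsState τ → 0 ≤ (E * (σ ⊗ₖ τ)).trace.re) : IsBlockPos E := by
  refine ⟨hE, ?_⟩
  rintro _ ⟨L, p, σ, τ, hp, hσ, hτ, rfl⟩
  rw [Finset.mul_sum, trace_sum]
  refine Finset.sum_nonneg fun l _ => ?_
  rw [mul_smul_comm, trace_smul, smul_eq_mul]
  refine mul_nonneg (by exact_mod_cast hp l)
    (Complex.le_def.mpr ⟨h _ _ (hσ l) (hτ l), ?_⟩)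
  exact (hE.im_trace_mul ((hσ l).kronecker (hτ l)).1.1).symm

theorem IsBlockPos.dotProduct_mulVec_nonneg [Nonempty a] [Nonempty b]
    {E : Matrix (a × b) (a × b) ℂ} (hE : IsBlockPos E) (x : a → ℂ) (y : b → ℂ) :
    0 ≤ star (fun p : a × b => x p.1 * y p.2) ⬝ᵥ E *ᵥ (fun p : a × b => x p.1 * y p.2) := by
  obtain ⟨r, σ, hr, hσ, hrσ⟩ := (posSemidef_vecMulVec_self_star x).exists_eq_smul_isState
  obtain ⟨s, τ, hs, hτ, hsτ⟩ := (posSemidef_vecMulVec_self_star y).exists_eq_smul_isState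
  have hvec : vecMulVec (fun p : a × b => x p.1 * y p.2)
      (star fun p : a × b => x p.1 * y p.2) = ((r : ℂ) * s) • (σ ⊗ₖ τ) := by
    rw [← smul_smul, ← kronecker_smul, ← smul_kronecker, ← hrσ, ← hsτ]
    ext p p'
    simp [vecMulVec_apply, kroneckerMap_apply]
    ring
  rw [dotProduct_comm, ← trace_vecMulVec, ← mul_vecMulVec, hvec, mul_smul_comm, trace_smul,
    smul_eq_mul]
  exact mul_nonneg (mul_nonneg (by exact_mod_cast hr) (by exact_mod_cast hs))
    (hE.2 _ (hσ.isSep_kronecker hτ))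

/-- An operator that is strictly positive on product states stays block positive after
subtracting a small multiple of any Hermitian operator. -/
theorem exists_isBlockPos_sub_smul [Nonempty a] [Nonempty b] {E R : Matrix (a × b) (a × b) ℂ}
    (hE : E.IsHermitian) (hR : R.IsHermitian)
    (h : ∀ σ τ, IsState σ → IsState τ → 0 < (E * (σ ⊗ₖ τ)).trace.re) :
    ∃ ε : ℝ, 0 < ε ∧ IsBlockPos (E - (ε : ℂ) • R) := by
  have hK : IsCompact ({σ : Matrix a a ℂ | IsState σ} ×ˢ {τ : Matrix b b ℂ | IsState τ}) :=
    isCompact_setOf_isState.prod isCompact_setOf_isState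
  have hne : ({σ : Matrix a a ℂ | IsState σ} ×ˢ {τ : Matrix b b ℂ | IsState τ}).Nonempty :=
    nonempty_setOf_isState.prod nonempty_setOf_isState
  have hcont (M : Matrix (a × b) (a × b) ℂ) :
      Continuous fun p : Matrix a a ℂ × Matrix b b ℂ => (M * (p.1 ⊗ₖ p.2)).trace.re := by
    refine Complex.continuous_re.comp
      (Continuous.matrix_trace (Continuous.matrix_mul continuous_const ?_))
    exact continuous_matrix fun i k => by simp only [kroneckerMap_apply]; fun_prop
  obtain ⟨p₁, hp₁, hmin⟩ := hK.exists_isMinOn hne (hcont E).continuousOn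
  obtain ⟨p₂, -, hmax⟩ := hK.exists_isMaxOn hne (hcont R).continuousOn
  have hδ := h _ _ hp₁.1 hp₁.2
  set δ := (E * (p₁.1 ⊗ₖ p₁.2)).trace.re
  set m := (R * (p₂.1 ⊗ₖ p₂.2)).trace.re
  have hε : 0 < δ / (|m| + 1) := by positivity
  refine ⟨δ / (|m| + 1), hε, .of_re_trace_nonneg (hE.sub ?_) fun σ τ hσ hτ => ?_⟩
  · exact hR.smul (Complex.conj_ofReal _)
  · have h₁ : δ ≤ (E * (σ ⊗ₖ τ)).trace.re := isMinOn_iff.mp hmin (σ, τ) ⟨hσ, hτ⟩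
    have h₂ : (R * (σ ⊗ₖ τ)).trace.re ≤ m := isMaxOn_iff.mp hmax (σ, τ) ⟨hσ, hτ⟩
    have h₃ : δ / (|m| + 1) * (R * (σ ⊗ₖ τ)).trace.re ≤ δ / (|m| + 1) * (|m| + 1) :=
      mul_le_mul_of_nonneg_left (by linarith [le_abs_self m]) hε.le
    rw [div_mul_cancel₀ _ (by positivity)] at h₃
    rw [sub_mul, trace_sub, smul_mul_assoc, trace_smul, Complex.sub_re, smul_eq_mul,
      Complex.re_ofReal_mul]
    linarith

end

/-- A two-qubit block-positive operator with a product vector in its kernel is positive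
semidefinite: modulo that vector, almost every vector is a product vector. -/
theorem IsBlockPos.posSemidef_of_mulVec_eq_zero
    {W : Matrix (Fin 2 × Fin 2) (Fin 2 × Fin 2) ℂ} (hW : IsBlockPos W) {x y : Fin 2 → ℂ}
    (hx : x ≠ 0) (hy : y ≠ 0) (hker : W *ᵥ (fun p => x p.1 * y p.2) = 0) : W.PosSemidef := by
  set v : Fin 2 × Fin 2 → ℂ := fun p => x p.1 * y p.2 with hv
  have hker' : star v ᵥ* W = 0 := by
    rw [← hW.1.eq, ← star_mulVec, hker, star_zero]
  let β : (Fin 2 × Fin 2 → ℂ) → ℂ := fun w =>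
    w (0, 0) * v (1, 1) + w (1, 1) * v (0, 0) - w (0, 1) * v (1, 0) - w (1, 0) * v (0, 1)
  have hβ_add (w z : Fin 2 × Fin 2 → ℂ) (c : ℂ) : β (w + c • z) = β w + c * β z := by
    simp only [β, Pi.add_apply, Pi.smul_apply, smul_eq_mul]
    ring
  have hgen (w : Fin 2 × Fin 2 → ℂ) (hw : β w ≠ 0) : 0 ≤ star w ⬝ᵥ W *ᵥ w := by
    set c : ℂ := -(w (0, 0) * w (1, 1) - w (0, 1) * w (1, 0)) / β w with hc
    have hcβ : c * β w = -(w (0, 0) * w (1, 1) - w (0, 1) * w (1, 0)) := div_mul_cancel₀ _ hw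
    obtain ⟨s, t, hst⟩ := exists_apply_eq_mul_of_det_eq_zero
      (M := of fun i k => (w + c • v) (i, k)) (by
        simp only [det_fin_two, of_apply, Pi.add_apply, Pi.smul_apply, smul_eq_mul]
        simp only [β, hv] at hcβ ⊢
        linear_combination hcβ)
    have hprod : w + c • v = fun p => s p.1 * t p.2 := funext fun p => hst p.1 p.2
    have hpos := hW.dotProduct_mulVec_nonneg s t
    rwa [← hprod, mulVec_add, mulVec_smul, hker, smul_zero, add_zero, star_add, star_smul,
      add_dotProduct, smul_dotProduct, dotProduct_mulVec (star v), hker', zero_dotProduct,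
      smul_zero, add_zero] at hpos
  obtain ⟨z, hz⟩ : ∃ z, β z ≠ 0 := by
    obtain ⟨i, hi⟩ := Function.ne_iff.mp hx
    obtain ⟨k, hk⟩ := Function.ne_iff.mp hy
    have hik : v (i, k) ≠ 0 := mul_ne_zero hi hk
    refine ⟨Pi.single (i + 1, k + 1) 1, ?_⟩
    fin_cases i <;> fin_cases k <;> simpa [β, Pi.single_apply] using hik
  refine .of_dotProduct_mulVec_nonneg hW.1 fun w => ?_
  by_cases hw : β w = 0
  · have hcont : Continuous fun c : ℂ => star (w + c • z) ⬝ᵥ W *ᵥ (w + c • z) := by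
      fun_prop
    have hlim := (hcont.tendsto 0).mono_left (nhdsWithin_le_nhds (s := {0}ᶜ))
    rw [zero_smul, add_zero] at hlim
    refine ge_of_tendsto hlim (eventually_nhdsWithin_of_forall fun c hc => hgen _ ?_)
    rw [hβ_add, hw, zero_add]
    exact mul_ne_zero hc hz
  · exact hgen w hw

/-- An operator annihilating a nonzero product operator annihilates a nonzero product vector. -/
theorem exists_kronecker_mulVec_eq_zero {a b : Type*} [Fintype a] [Fintype b]
    {W : Matrix (a × b) (a × b) ℂ} {σ : Matrix a a ℂ} {τ : Matrix b b ℂ}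
    (hσ : σ ≠ 0) (hτ : τ ≠ 0) (h : W * (σ ⊗ₖ τ) = 0) :
    ∃ (x : a → ℂ) (y : b → ℂ), x ≠ 0 ∧ y ≠ 0 ∧ W *ᵥ (fun p => x p.1 * y p.2) = 0 := by
  obtain ⟨i, k, hik⟩ : ∃ i k, σ i k ≠ 0 := by
    by_contra! h0
    exact hσ (ext h0)
  obtain ⟨i', k', hik'⟩ : ∃ i k, τ i k ≠ 0 := by
    by_contra! h0
    exact hτ (ext h0)
  refine ⟨fun i => σ i k, fun i => τ i k', fun h0 => hik (congrFun h0 i),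
    fun h0 => hik' (congrFun h0 i'), funext fun p => ?_⟩
  exact congrFun (congrFun h p) (k, k')

/-- Corollary 1, first part: for a two-qubit ensemble,
`Q j = q < C j` iff `q • ρ₀ - η j • ρ j` is a weakly-optimal entanglement witness. -/
theorem twoQubit_Q_eq_lt_C_iff_weaklyOptimal_EW
    {n : ℕ} (η : Fin n → ℝ)
    (ρ : Fin n → Matrix (Fin 2 × Fin 2) (Fin 2 × Fin 2) ℂ)
    (hηpos : ∀ i, 0 < η i) (hηsum : ∑ i, η i = 1) (hρ : ∀ i, IsState (ρ i))
    (j : Fin n) (ρ₀ : Matrix (Fin 2 × Fin 2) (Fin 2 × Fin 2) ℂ)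
    (hρ₀ : ρ₀ = ∑ i, (η i : ℂ) • ρ i) (q C : ℝ)
    (hC : IsLeast {t : ℝ | ((t : ℂ) • ρ₀ - (η j : ℂ) • ρ j).PosSemidef} C) :
    (IsLeast {t : ℝ | IsBlockPos ((t : ℂ) • ρ₀ - (η j : ℂ) • ρ j)} q ∧ q < C) ↔
      (IsBlockPos ((q : ℂ) • ρ₀ - (η j : ℂ) • ρ j) ∧
        ¬ ((q : ℂ) • ρ₀ - (η j : ℂ) • ρ j).PosSemidef ∧
        ∃ σ : Matrix (Fin 2 × Fin 2) (Fin 2 × Fin 2) ℂ,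
          IsSep σ ∧ σ.trace = 1 ∧
          (σ * ((q : ℂ) • ρ₀ - (η j : ℂ) • ρ j)).trace = 0) := by

  have hρ₀psd : ρ₀.PosSemidef := by
    rw [hρ₀]
    exact posSemidef_sum _ fun i _ => (hρ i).1.smul (by exact_mod_cast (hηpos i).le)
  have hherm (t : ℝ) : ((t : ℂ) • ρ₀ - (η j : ℂ) • ρ j).IsHermitian :=
    (hρ₀psd.1.smul (Complex.conj_ofReal _)).sub ((hρ j).1.1.smul (Complex.conj_ofReal _))
  have hshift (s t : ℝ) : (s : ℂ) • ρ₀ - (η j : ℂ) • ρ j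
      = (t : ℂ) • ρ₀ - (η j : ℂ) • ρ j + ((s - t : ℝ) : ℂ) • ρ₀ := by
    push_cast
    module
  constructor
  · rintro ⟨⟨hBP, hleast⟩, hqC⟩
    refine ⟨hBP, fun hpsd => hqC.not_ge (hC.2 hpsd), ?_⟩
    by_contra! hno
    obtain ⟨ε, hε, hlow⟩ := exists_isBlockPos_sub_smul (hherm q) hρ₀psd.1 fun σ τ hσ hτ => by
      obtain ⟨hre, him⟩ := Complex.le_def.mp (hBP.2 _ (hσ.isSep_kronecker hτ))
      refine lt_of_le_of_ne hre fun h0 => ?_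
      refine hno _ (hσ.isSep_kronecker hτ) (hσ.kronecker hτ).2 ?_
      rw [trace_mul_comm]
      exact (Complex.ext h0 him).symm
    have hmem : IsBlockPos (((q - ε : ℝ) : ℂ) • ρ₀ - (η j : ℂ) • ρ j) := by
      convert hlow using 1
      push_cast
      module
    linarith [hleast hmem]
  · rintro ⟨hBP, hnpsd, F, hF, hFtr, hF0⟩
    refine ⟨⟨hBP, fun t ht => ?_⟩, ?_⟩
    · by_contra! htq
      obtain ⟨L, p, σ, τ, hp, hσ, hτ, rfl⟩ := id hF
      have hterm (l : Fin L) : 0 ≤ (p l : ℂ) * (ρ₀ * (σ l ⊗ₖ τ l)).trace :=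
        mul_nonneg (by exact_mod_cast hp l)
          (hρ₀psd.trace_mul_nonneg ((hσ l).kronecker (hτ l)).1)
      have hsum : ∑ l, (p l : ℂ) * (ρ₀ * (σ l ⊗ₖ τ l)).trace = 0 := by
        refine le_antisymm ?_ (Finset.sum_nonneg fun l _ => hterm l)
        have h := ht.2 _ hF
        rw [hshift t q, add_mul, trace_add, trace_mul_comm, hF0, zero_add, Finset.mul_sum,
          trace_sum] at h
        simp only [mul_smul_comm, smul_mul_assoc, trace_smul, smul_eq_mul, ← mul_assoc] at h
        simp only [mul_comm _ ((t - q : ℝ) : ℂ), mul_assoc, ← Finset.mul_sum] at h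
        have hne : ((t - q : ℝ) : ℂ) ≠ 0 := by exact_mod_cast (sub_neg.mpr htq).ne
        have hinv : (((t - q)⁻¹ : ℝ) : ℂ) ≤ 0 := by
          exact_mod_cast inv_nonpos.mpr (sub_neg.mpr htq).le
        have h' := mul_nonpos_of_nonpos_of_nonneg hinv h
        rwa [Complex.ofReal_inv, inv_mul_cancel_left₀ hne] at h'
      obtain ⟨l, hl⟩ : ∃ l, p l ≠ 0 := by
        by_contra! h0
        simp [h0] at hFtr
      have hS := ((hσ l).kronecker (hτ l)).1
      have hρ₀S : (ρ₀ * (σ l ⊗ₖ τ l)).trace = 0 := by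
        have h := (Finset.sum_eq_zero_iff_of_nonneg fun l _ => hterm l).mp hsum l
          (Finset.mem_univ l)
        exact (mul_eq_zero.mp h).resolve_left (by exact_mod_cast hl)
      have hρjS : (ρ j * (σ l ⊗ₖ τ l)).trace = 0 := by
        have h := hρ₀S
        rw [hρ₀, Finset.sum_mul, trace_sum] at h
        simp only [smul_mul_assoc, trace_smul, smul_eq_mul] at h
        have h' := (Finset.sum_eq_zero_iff_of_nonneg fun i _ =>
          mul_nonneg (by exact_mod_cast (hηpos i).le) ((hρ i).1.trace_mul_nonneg hS)).mp h j
          (Finset.mem_univ j)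
        exact (mul_eq_zero.mp h').resolve_left (by exact_mod_cast (hηpos j).ne')
      have hne {σ : Matrix (Fin 2) (Fin 2) ℂ} (hσ : IsState σ) : σ ≠ 0 := by
        rintro rfl
        simpa using hσ.2
      have hWS : ((q : ℂ) • ρ₀ - (η j : ℂ) • ρ j) * (σ l ⊗ₖ τ l) = 0 := by
        rw [sub_mul, smul_mul_assoc, smul_mul_assoc,
          hρ₀psd.mul_eq_zero_of_trace_mul_eq_zero hS hρ₀S,
          (hρ j).1.mul_eq_zero_of_trace_mul_eq_zero hS hρjS, smul_zero, smul_zero, sub_zero]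
      obtain ⟨x, y, hx, hy, hker⟩ := exists_kronecker_mulVec_eq_zero (hne (hσ l)) (hne (hτ l)) hWS
      exact hnpsd (hBP.posSemidef_of_mulVec_eq_zero hx hy hker)
    · by_contra! hCq
      refine hnpsd ?_
      rw [hshift q C]
      exact PosSemidef.add hC.1 (hρ₀psd.smul (by exact_mod_cast sub_nonneg.mpr hCq))
end

section
/- Let E = {(η_i, ρ_i)}_{i=1}^n be a two-qubit quantum state ensemble (states on C^2 ⊗ C^2) whose average state ρ_0 = Σ_i η_i ρ_i is not of full rank. Then for every j ∈ {1,...,n}, Q_j(E) = C_j(E); i.e., the maximum confidence to identify ρ_j is achievable by separable measurements. -/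
open ComplexOrder

open Kronecker

open Matrix

/-- The product vector `a ⊗ b`. -/
def productVector {α β : Type*} (a : α → ℂ) (b : β → ℂ) : α × β → ℂ :=
  fun i => a i.1 * b i.2

lemma isState_normalized_vecMulVec {ι : Type*} [Fintype ι] {a : ι → ℂ} (ha : a ≠ 0) :
    ∃ r : ℝ, 0 ≤ r ∧ ∃ σ : Matrix ι ι ℂ, IsState σ ∧ vecMulVec a (star a) = (r : ℂ) • σ := by
  have hpos : 0 < star a ⬝ᵥ a := dotProduct_star_self_pos_iff.mpr ha
  obtain ⟨hre, him⟩ := Complex.pos_iff.mp hpos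
  have hr : ((star a ⬝ᵥ a).re : ℂ) = star a ⬝ᵥ a := Complex.ext rfl (by simpa using him)
  have hne : ((star a ⬝ᵥ a).re : ℂ) ≠ 0 := by rw [hr]; exact hpos.ne'
  refine ⟨(star a ⬝ᵥ a).re, hre.le, (((star a ⬝ᵥ a).re : ℂ))⁻¹ • vecMulVec a (star a),
    ⟨(posSemidef_vecMulVec_self_star a).smul ?_, ?_⟩, ?_⟩
  · rw [hr]; exact (inv_pos.mpr hpos).le
  · rw [trace_smul, trace_vecMulVec, smul_eq_mul, dotProduct_comm a, hr,
      inv_mul_cancel₀ hpos.ne']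
  · rw [smul_smul, mul_inv_cancel₀ hne, one_smul]

lemma isSep_vecMulVec_productVector {α β : Type*} [Fintype α] [Fintype β]
    (a : α → ℂ) (b : β → ℂ) :
    IsSep (vecMulVec (productVector a b) (star (productVector a b))) := by
  have hK : vecMulVec (productVector a b) (star (productVector a b)) =
      vecMulVec a (star a) ⊗ₖ vecMulVec b (star b) := by
    ext i j
    simp [productVector, vecMulVec_apply, kroneckerMap_apply]
    ring
  rw [hK]
  by_cases ha : a = 0
  · exact ⟨0, Fin.elim0, Fin.elim0, Fin.elim0, fun l => l.elim0, fun l => l.elim0,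
      fun l => l.elim0, by simp [ha]⟩
  by_cases hb : b = 0
  · exact ⟨0, Fin.elim0, Fin.elim0, Fin.elim0, fun l => l.elim0, fun l => l.elim0,
      fun l => l.elim0, by simp [hb]⟩
  obtain ⟨r, hr, σ, hσ, ea⟩ := isState_normalized_vecMulVec ha
  obtain ⟨s, hs, τ, hτ, eb⟩ := isState_normalized_vecMulVec hb
  refine ⟨1, fun _ => r * s, fun _ => σ, fun _ => τ, fun _ => mul_nonneg hr hs, fun _ => hσ,
    fun _ => hτ, ?_⟩
  rw [ea, eb]
  simp [smul_kronecker, kronecker_smul, smul_smul, mul_comm (r : ℂ), -Complex.coe_smul]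

lemma IsBlockPos.dotProduct_mulVec_productVector_nonneg {α β : Type*} [Fintype α] [Fintype β]
    {W : Matrix (α × β) (α × β) ℂ} (hW : IsBlockPos W) (a : α → ℂ) (b : β → ℂ) :
    0 ≤ star (productVector a b) ⬝ᵥ W *ᵥ productVector a b := by
  have h := hW.2 _ (isSep_vecMulVec_productVector a b)
  rwa [mul_vecMulVec, trace_vecMulVec, dotProduct_comm] at h

open scoped MatrixOrder in
lemma Matrix.PosSemidef.trace_mul_nonneg_of_posSemidef {ι : Type*} [Fintype ι]
    {A B : Matrix ι ι ℂ} (hA : A.PosSemidef) (hB : B.PosSemidef) : 0 ≤ (A * B).trace := by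
  classical
  obtain ⟨D, rfl⟩ := CStarAlgebra.nonneg_iff_eq_star_mul_self.mp hB.nonneg
  rw [← Matrix.mul_assoc, trace_mul_comm, ← Matrix.mul_assoc]
  exact (hA.mul_mul_conjTranspose_same D).trace_nonneg

lemma Matrix.PosSemidef.isBlockPos {α β : Type*} [Fintype α] [Fintype β]
    {W : Matrix (α × β) (α × β) ℂ} (hW : W.PosSemidef) : IsBlockPos W := by
  refine ⟨hW.1, ?_⟩
  rintro _ ⟨L, p, σ, τ, hp, hσ, hτ, rfl⟩
  refine hW.trace_mul_nonneg_of_posSemidef (posSemidef_sum _ fun l _ => ?_)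
  exact ((hσ l).1.kronecker (hτ l).1).smul (by exact_mod_cast hp l)

/-- The determinant of a two-qubit vector, viewed as a `2 × 2` matrix of amplitudes. -/
def amplitudeDet (u : Fin 2 × Fin 2 → ℂ) : ℂ :=
  u (0, 0) * u (1, 1) - u (0, 1) * u (1, 0)

/-- The polar form of `amplitudeDet`. -/
def amplitudeDetPolar (u v : Fin 2 × Fin 2 → ℂ) : ℂ :=
  u (0, 0) * v (1, 1) + u (1, 1) * v (0, 0) - u (0, 1) * v (1, 0) - u (1, 0) * v (0, 1)

lemma exists_eq_productVector {u : Fin 2 × Fin 2 → ℂ} (hu : amplitudeDet u = 0) :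
    ∃ a b : Fin 2 → ℂ, u = productVector a b := by
  unfold amplitudeDet at hu
  by_cases h0 : u (0, 0) = 0
  · by_cases h1 : u (0, 1) = 0
    · refine ⟨![0, 1], ![u (1, 0), u (1, 1)], ?_⟩
      ext ⟨i, j⟩
      fin_cases i <;> fin_cases j <;> simp [productVector, h0, h1]
    · refine ⟨![1, u (1, 1) / u (0, 1)], ![u (0, 0), u (0, 1)], ?_⟩
      ext ⟨i, j⟩
      fin_cases i <;> fin_cases j <;> simp [productVector, h1]
      field_simp
      linear_combination -hu
  · refine ⟨![1, u (1, 0) / u (0, 0)], ![u (0, 0), u (0, 1)], ?_⟩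
    ext ⟨i, j⟩
    fin_cases i <;> fin_cases j <;> simp [productVector, h0]
    field_simp
    linear_combination hu

lemma exists_amplitudeDet_add_smul_eq_zero {u v : Fin 2 × Fin 2 → ℂ}
    (h : amplitudeDetPolar u v ≠ 0) :
    ∃ t : ℂ, amplitudeDet (u + t • v) = 0 := by
  have hexp : ∀ t : ℂ, amplitudeDet (u + t • v) =
      amplitudeDet v * (t * t) + amplitudeDetPolar u v * t + amplitudeDet u := fun t => by
    simp only [amplitudeDet, amplitudeDetPolar, Pi.add_apply, Pi.smul_apply, smul_eq_mul]
    ring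
  simp only [hexp]
  by_cases hv : amplitudeDet v = 0
  · refine ⟨-amplitudeDet u / amplitudeDetPolar u v, ?_⟩
    rw [hv]
    field_simp
    ring
  · refine exists_quadratic_eq_zero hv ?_
    obtain ⟨s, hs⟩ := IsAlgClosed.exists_pow_nat_eq
      (discrim (amplitudeDet v) (amplitudeDetPolar u v) (amplitudeDet u)) (n := 2) two_pos
    exact ⟨s, by rw [← hs, sq]⟩

lemma exists_amplitudeDetPolar_ne_zero {v : Fin 2 × Fin 2 → ℂ} (hv : v ≠ 0) :
    ∃ w, amplitudeDetPolar w v ≠ 0 := by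
  by_contra! h
  refine hv ?_
  ext ⟨i, j⟩
  have := h (Pi.single (1 - i, 1 - j) 1)
  fin_cases i <;> fin_cases j <;> simpa [amplitudeDetPolar, Pi.single_apply] using this

lemma Matrix.IsHermitian.dotProduct_mulVec_add_smul_of_mulVec_eq_zero {ι : Type*} [Fintype ι]
    {W : Matrix ι ι ℂ} (hW : W.IsHermitian) {v : ι → ℂ} (hv : W *ᵥ v = 0) (u : ι → ℂ) (t : ℂ) :
    star (u + t • v) ⬝ᵥ W *ᵥ (u + t • v) = star u ⬝ᵥ W *ᵥ u := by
  have h : star v ⬝ᵥ W *ᵥ u = 0 := by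
    rw [dotProduct_mulVec, ← hW.eq, ← star_mulVec, hv, star_zero, zero_dotProduct]
  simp [mulVec_add, mulVec_smul, hv, add_dotProduct, h]

/-- A block-positive two-qubit operator with a nonzero kernel vector `v` is positive semidefinite:
modulo `v`, almost every vector is a product vector. -/
lemma IsBlockPos.posSemidef_of_mulVec_eq_zero_s7
    {W : Matrix (Fin 2 × Fin 2) (Fin 2 × Fin 2) ℂ} (hW : IsBlockPos W)
    {v : Fin 2 × Fin 2 → ℂ} (hv : v ≠ 0) (hWv : W *ᵥ v = 0) : W.PosSemidef := by
  have key : ∀ u, amplitudeDetPolar u v ≠ 0 → 0 ≤ star u ⬝ᵥ W *ᵥ u := fun u hu => by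
    obtain ⟨t, ht⟩ := exists_amplitudeDet_add_smul_eq_zero hu
    obtain ⟨a, b, hab⟩ := exists_eq_productVector ht
    rw [← hW.1.dotProduct_mulVec_add_smul_of_mulVec_eq_zero hWv u t, hab]
    exact hW.dotProduct_mulVec_productVector_nonneg a b
  refine PosSemidef.of_dotProduct_mulVec_nonneg hW.1 fun u => ?_
  by_cases hu : amplitudeDetPolar u v = 0
  · obtain ⟨w, hw⟩ := exists_amplitudeDetPolar_ne_zero hv
    have hclosed : IsClosed {s : ℂ | 0 ≤ star (u + s • w) ⬝ᵥ W *ᵥ (u + s • w)} :=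
      isClosed_le continuous_const (by fun_prop)
    have hsub : ({0}ᶜ : Set ℂ) ⊆ {s : ℂ | 0 ≤ star (u + s • w) ⬝ᵥ W *ᵥ (u + s • w)} := by
      intro s hs
      refine key _ ?_
      have : amplitudeDetPolar (u + s • w) v =
          amplitudeDetPolar u v + s * amplitudeDetPolar w v := by
        simp only [amplitudeDetPolar, Pi.add_apply, Pi.smul_apply, smul_eq_mul]
        ring
      rw [this, hu, zero_add]
      exact mul_ne_zero hs hw
    have h0 := hclosed.closure_subset_iff.mpr hsub (dense_compl_singleton (0 : ℂ) 0)
    simpa using h0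
  · exact key u hu

lemma mulVec_eq_zero_of_sum_smul_mulVec_eq_zero {ι κ : Type*} [Fintype ι] [Fintype κ]
    {η : κ → ℝ} {ρ : κ → Matrix ι ι ℂ} (hη : ∀ i, 0 < η i) (hρ : ∀ i, (ρ i).PosSemidef)
    {v : ι → ℂ} (hv : (∑ i, (η i : ℂ) • ρ i) *ᵥ v = 0) (j : κ) : ρ j *ᵥ v = 0 := by
  rw [← (hρ j).dotProduct_mulVec_zero_iff]
  have hsum : ∑ i, (η i : ℂ) * (star v ⬝ᵥ ρ i *ᵥ v) = 0 := by
    have := congrArg (fun x => star v ⬝ᵥ x) hv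
    simpa [sum_mulVec, dotProduct_sum, smul_mulVec, dotProduct_smul] using this
  have hη' : ∀ i, (0 : ℂ) < η i := fun i => by exact_mod_cast hη i
  have := (Finset.sum_eq_zero_iff_of_nonneg fun i _ =>
    mul_nonneg (hη' i).le ((hρ i).dotProduct_mulVec_nonneg v)).mp hsum j (Finset.mem_univ j)
  exact (mul_eq_zero.mp this).resolve_left (hη' j).ne'

lemma Matrix.exists_mulVec_eq_zero_of_rank_lt {ι K : Type*} [Fintype ι] [Field K]
    {A : Matrix ι ι K} (hA : A.rank < Fintype.card ι) : ∃ v ≠ 0, A *ᵥ v = 0 := by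
  classical
  rw [exists_mulVec_eq_zero_iff]
  by_contra hdet
  exact hA.ne (rank_of_isUnit A ((isUnit_iff_isUnit_det A).mpr (Ne.isUnit hdet)))

/-- Corollary 1, second part: for a two-qubit ensemble whose average
state `ρ₀` is not of full rank, `Q j = C j` for every `j`. -/
theorem twoQubit_not_fullRank_Q_eq_C
    {n : ℕ} (η : Fin n → ℝ)
    (ρ : Fin n → Matrix (Fin 2 × Fin 2) (Fin 2 × Fin 2) ℂ)
    (hηpos : ∀ i, 0 < η i) (hηsum : ∑ i, η i = 1) (hρ : ∀ i, IsState (ρ i))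
    (ρ₀ : Matrix (Fin 2 × Fin 2) (Fin 2 × Fin 2) ℂ)
    (hρ₀ : ρ₀ = ∑ i, (η i : ℂ) • ρ i)
    (hrank : ρ₀.rank < Fintype.card (Fin 2 × Fin 2)) :
    ∀ j : Fin n, ∀ Q C : ℝ,
      IsLeast {t : ℝ | IsBlockPos ((t : ℂ) • ρ₀ - (η j : ℂ) • ρ j)} Q →
      IsLeast {t : ℝ | ((t : ℂ) • ρ₀ - (η j : ℂ) • ρ j).PosSemidef} C →
      Q = C := by
  intro j Q C hQ hC
  obtain ⟨v, hv, hv₀⟩ := exists_mulVec_eq_zero_of_rank_lt hrank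
  have hvj := mulVec_eq_zero_of_sum_smul_mulVec_eq_zero hηpos (fun i => (hρ i).1)
    (hρ₀ ▸ hv₀) j
  refine le_antisymm (hQ.2 hC.1.isBlockPos) (hC.2 ?_)
  refine IsBlockPos.posSemidef_of_mulVec_eq_zero_s7 hQ.1 hv ?_
  rw [sub_mulVec, smul_mulVec, smul_mulVec, hv₀, hvj, smul_zero, smul_zero, sub_zero]
end
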